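/- arXiv:1907.09641 — 2 statements merged into one kernel-verified Lean document; each statement's English description precedes it below -/
import Mathlib

section
/- Let α < 0 and β < 0 be real numbers. Then ⌊α⌊βx⌋⌋ ≥ ⌊β⌊αx⌋⌋ holds for all real x if and only if at least one of the following conditions holds: (i) there exist integers m ≥ 0 and n ≥ 1 such that mαβ − nβ = −α; (ii) there exist coprime integers p, q ≥ 1 such that α = −q/p and −1/p ≤ β < 0; (iii*) there exist coprime integers p, q ≥ 1 and integers m ≥ 0, n ≥ 1, r ≥ 1 such that α = −q/p and β = −(1/p)·(1 + (1/r)·(m/p + n/q − 1))⁻¹. -/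
/-- The reformulated commutator condition. -/
def NDCond (a b : ℝ) : Prop :=
  ∀ j l : ℤ, (l : ℝ) < j * a → b * Int.fract (j * (a / b)) < j * a - l

theorem ndCond_iff (α β : ℝ) (hα : α < 0) (hβ : β < 0) :
    (∀ x : ℝ, ⌊α * (⌊β * x⌋ : ℝ)⌋ ≥ ⌊β * (⌊α * x⌋ : ℝ)⌋) ↔ NDCond (-α) (-β) := by
  have key : ∀ j : ℤ, -β * Int.fract ((j : ℝ) * (-α / -β)) = -(j * α) + β * ⌊α * (j / β)⌋ := by
    intro j
    have e : (j : ℝ) * (-α / -β) = α * (j / β) := by rw [neg_div_neg_eq]; ring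
    have e2 : β * (α * (j / β)) = j * α := by
      rw [← mul_assoc, mul_comm β α, mul_assoc, mul_div_cancel₀ _ hβ.ne]; ring
    rw [e, Int.fract]
    linear_combination -e2
  constructor
  · intro h j l hl
    have h1 := h (j / β)
    have e : β * ((j : ℝ) / β) = j := by field_simp [hβ.ne]
    rw [e, Int.floor_intCast] at h1
    rw [key]
    have h2 : ⌊α * (j : ℝ)⌋ < -l := by
      rw [Int.floor_lt]; push_cast; linarith
    have h3 : ⌊β * (⌊α * ((j : ℝ) / β)⌋ : ℝ)⌋ < -l := lt_of_le_of_lt h1 h2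
    rw [Int.floor_lt] at h3
    push_cast at h3
    linarith
  · intro h x
    by_contra hc
    push Not at hc
    rw [Int.floor_lt] at hc
    set K := ⌊β * (⌊α * x⌋ : ℝ)⌋ with hK
    have hKle : (K : ℝ) ≤ β * (⌊α * x⌋ : ℝ) := Int.floor_le _
    have h1 := h ⌊β * x⌋ (-K) (by push_cast; linarith)
    rw [key] at h1
    push_cast at h1
    have hj : (⌊β * x⌋ : ℝ) ≤ β * x := Int.floor_le _
    have h2 : x ≤ (⌊β * x⌋ : ℝ) / β := by
      rw [le_div_iff_of_neg hβ]; linarith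
    have h3 : α * ((⌊β * x⌋ : ℝ) / β) ≤ α * x := mul_le_mul_of_nonpos_left h2 hα.le
    have h4 : (⌊α * ((⌊β * x⌋ : ℝ) / β)⌋ : ℝ) ≤ ⌊α * x⌋ := by exact_mod_cast Int.floor_le_floor h3
    have h5 := mul_le_mul_of_nonpos_left h4 hβ.le
    linarith

theorem fract_le_self_nd {z : ℝ} (hz : 0 ≤ z) : Int.fract z ≤ z := by
  have : (0 : ℝ) ≤ ⌊z⌋ := by exact_mod_cast Int.floor_nonneg.2 hz
  have := Int.self_sub_floor z
  linarith

theorem nd_suff_one (a b : ℝ) (ha : 0 < a) (hb : 0 < b) (m n : ℤ) (hm : 0 ≤ m) (hn : 1 ≤ n)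
    (h : a / b = m * a + n) : NDCond a b := by
  intro j l hl
  have e : (j : ℝ) * (a / b) = m * (j * a - l) + ((m * l + j * n : ℤ) : ℝ) := by
    rw [h]; push_cast; ring
  rw [e, Int.fract_add_intCast]
  have hy : 0 < j * a - l := by linarith
  have hm' : (0 : ℝ) ≤ m := by exact_mod_cast hm
  have hn' : (1 : ℝ) ≤ n := by exact_mod_cast hn
  have h1 := fract_le_self_nd (mul_nonneg hm' hy.le)
  have h2 : a = b * (m * a + n) := by rw [← h]; field_simp
  have h3 : b * m < 1 := by
    have : 0 < b * n := by positivity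
    by_contra hc
    push Not at hc
    nlinarith
  have h4 := mul_le_mul_of_nonneg_left h1 hb.le
  nlinarith

theorem nd_suff_two (a b : ℝ) (hb : 0 < b) (p q : ℤ) (hp : 1 ≤ p)
    (h : a = q / p) (hbp : b ≤ 1 / p) : NDCond a b := by
  intro j l hl
  have hp' : (0 : ℝ) < p := by exact_mod_cast hp
  have hk : (j : ℝ) * a - l = ((j * q - l * p : ℤ) : ℝ) / p := by
    rw [h]; push_cast; field_simp
  have hpos : 0 < (j : ℝ) * a - l := by linarith
  rw [hk] at hpos ⊢
  have h1 : (1 : ℝ) ≤ ((j * q - l * p : ℤ) : ℝ) := by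
    have : (0 : ℝ) < ((j * q - l * p : ℤ) : ℝ) := (div_pos_iff_of_pos_right hp').1 hpos
    exact_mod_cast this
  have h2 : (1 : ℝ) / p ≤ ((j * q - l * p : ℤ) : ℝ) / p := by gcongr
  have h3 := Int.fract_lt_one ((j : ℝ) * (a / b))
  nlinarith

theorem nd_suff_three (a b : ℝ) (hb : 0 < b) (p q m n r : ℤ) (hp : 1 ≤ p) (hq : 1 ≤ q)
    (hm : 0 ≤ m) (hn : 1 ≤ n) (hr : 1 ≤ r)
    (h : a = q / p) (hbp : r = p * b * (r + m / p + n / q - 1)) : NDCond a b := by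
  intro j l hl
  have hp' : (0 : ℝ) < p := by exact_mod_cast hp
  have hq' : (0 : ℝ) < q := by exact_mod_cast hq
  have hr' : (0 : ℝ) < r := by exact_mod_cast hr
  have hn' : (0 : ℝ) < n := by exact_mod_cast hn
  have hm' : (0 : ℝ) ≤ m := by exact_mod_cast hm
  set k : ℤ := j * q - l * p with hkdef
  have hk : (j : ℝ) * a - l = (k : ℝ) / p := by
    rw [h, hkdef]; push_cast; field_simp
  have hpos : 0 < (j : ℝ) * a - l := by linarith
  rw [hk] at hpos ⊢
  have h1 : 1 ≤ k := by
    have : (0 : ℝ) < k := (div_pos_iff_of_pos_right hp').1 hpos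
    exact_mod_cast this
  have h1' : (1 : ℝ) ≤ k := by exact_mod_cast h1
  have hu : r * (a / b) = m * a + n + (r - 1) * q := by
    have : r * (a / b) = a * p * (r + m / p + n / q - 1) := by
      field_simp
      field_simp at hbp
      linear_combination a * hbp
    rw [this, h]; field_simp; ring
  set s : ℤ := m * l + j * n + j * (r - 1) * q - r * ⌊(j : ℝ) * (a / b)⌋ with hs
  have hf : r * Int.fract ((j : ℝ) * (a / b)) = m * (k / p) + s := by
    rw [Int.fract, hs, ← hk]; push_cast; linear_combination (j : ℝ) * hu
  have hlt := Int.fract_lt_one ((j : ℝ) * (a / b))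
  have hs1 : s ≤ r - 1 := by
    have h5 : (s : ℝ) < r := by
      have : 0 ≤ m * ((k : ℝ) / p) := by positivity
      nlinarith
    have : s < r := by exact_mod_cast h5
    omega
  have hs2 : (s : ℝ) ≤ k * (r - 1) := by
    have : s ≤ k * (r - 1) := by nlinarith
    exact_mod_cast this
  have h6 : r * Int.fract ((j : ℝ) * (a / b)) < k * (r + m / p + n / q - 1) := by
    rw [hf]
    have : 0 < k * ((n : ℝ) / q) := by positivity
    have e : (m : ℝ) * (k / p) = k * (m / p) := by ring
    rw [e]; nlinarith
  have h7 : (r : ℝ) * (b * Int.fract ((j : ℝ) * (a / b))) < r * (k / p) := by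
    have := mul_lt_mul_of_pos_left h6 hb
    have e : (r : ℝ) * (k / p) = b * (k * (r + m / p + n / q - 1)) := by
      rw [mul_div_assoc', div_eq_iff hp'.ne']
      linear_combination (k : ℝ) * hbp
    rw [e]; linarith
  exact lt_of_mul_lt_mul_left h7 hr'.le

theorem nd_dense (w : ℝ) (hw : Irrational w) (c d : ℝ) (hcd : c < d) :
    ∃ t s : ℤ, c < t * w + s ∧ t * w + s < d := by
  have hd : Dense (AddSubgroup.closure ({w, 1} : Set ℝ) : Set ℝ) := by
    rw [dense_addSubgroupClosure_pair_iff]; simpa using hw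
  obtain ⟨x, hx, hx1, hx2⟩ := hd.exists_between hcd
  rw [SetLike.mem_coe, AddSubgroup.mem_closure_pair] at hx
  obtain ⟨t, s, rfl⟩ := hx
  exact ⟨t, s, by simpa using hx1, by simpa using hx2⟩

theorem nd_irr (a b : ℝ) (ha : 0 < a) (hb : 0 < b) (hirr : Irrational a) (h : NDCond a b) :
    ∃ m n : ℤ, 0 ≤ m ∧ 1 ≤ n ∧ a / b = m * a + n := by
  have hex : ∀ k : ℕ, ∃ J L : ℤ, 0 < J * a - L ∧ J * a - L < 1 / ((k : ℝ) + 1) := by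
    intro k
    obtain ⟨t, s, h1, h2⟩ := nd_dense a hirr 0 (1 / ((k : ℝ) + 1)) (by positivity)
    exact ⟨t, -s, by push_cast; linarith, by push_cast; linarith⟩
  choose J L hpos hlt using hex
  set u := a / b with hu
  set δ : ℕ → ℝ := fun k => J k * a - L k with hδ
  set ε : ℕ → ℝ := fun k => Int.fract (J k * u) with hε
  have hεδ : ∀ k, b * ε k < δ k := fun k => h (J k) (L k) (by have := hpos k; linarith)
  have hδ0 : Filter.Tendsto δ Filter.atTop (nhds 0) :=
    squeeze_zero (fun k => (hpos k).le) (fun k => (hlt k).le) tendsto_one_div_add_atTop_nhds_zero_nat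
  have hρ : ∀ k, ε k / δ k ∈ Set.Icc 0 (1 / b) := by
    intro k
    have h1 : 0 < δ k := hpos k
    refine ⟨div_nonneg (Int.fract_nonneg _) h1.le, ?_⟩
    rw [div_le_div_iff₀ h1 hb]
    linarith [hεδ k]
  obtain ⟨μ, hμ, φ, hφ, hlim⟩ := isCompact_Icc.tendsto_subseq hρ
  have hδφ : Filter.Tendsto (fun k => δ (φ k)) Filter.atTop (nhds 0) := hδ0.comp hφ.tendsto_atTop
  have claim : ∀ j l : ℤ, ∃ z : ℤ, (z : ℝ) = j * u - (j * a - l) * μ := by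
    intro j l
    set Y := (j : ℝ) * a - l with hY
    set t : ℕ → ℤ := fun k => ⌈Y / δ (φ k)⌉ - 1 with ht
    have ht1 : ∀ k, 0 < Y - t k * δ (φ k) := by
      intro k
      have h1 : 0 < δ (φ k) := hpos _
      have h2 : (t k : ℝ) < Y / δ (φ k) := by
        have := Int.ceil_lt_add_one (Y / δ (φ k))
        simp only [ht]; push_cast; linarith
      rw [lt_div_iff₀ h1] at h2
      linarith
    have ht2 : ∀ k, Y - t k * δ (φ k) ≤ δ (φ k) := by
      intro k
      have h1 : 0 < δ (φ k) := hpos _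
      have h2 : Y / δ (φ k) ≤ t k + 1 := by
        have := Int.le_ceil (Y / δ (φ k))
        simp only [ht]; push_cast; linarith
      rw [div_le_iff₀ h1] at h2
      linarith
    have htY : Filter.Tendsto (fun k => (t k : ℝ) * δ (φ k)) Filter.atTop (nhds Y) := by
      have h1 : Filter.Tendsto (fun k => Y - t k * δ (φ k)) Filter.atTop (nhds 0) :=
        squeeze_zero (fun k => (ht1 k).le) ht2 hδφ
      have h2 := h1.const_sub Y
      simpa using h2
    set z : ℕ → ℝ := fun k => j * u - t k * δ (φ k) * (ε (φ k) / δ (φ k)) with hz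
    have hzlim : Filter.Tendsto z Filter.atTop (nhds (j * u - Y * μ)) :=
      (htY.mul hlim).const_sub _
    have hfr : ∀ k, Int.fract (z k) ≤ δ (φ k) / b := by
      intro k
      have h1 : 0 < δ (φ k) := hpos _
      have h2 := h (j - t k * J (φ k)) (l - t k * L (φ k)) (by
        have := ht1 k
        simp only [hδ, hY] at this
        push_cast; linarith)
      have e : ((j - t k * J (φ k) : ℤ) : ℝ) * u
          = z k - ((t k * ⌊(J (φ k) : ℝ) * u⌋ : ℤ) : ℝ) := by
        simp only [hz]
        rw [mul_assoc, mul_div_cancel₀ _ h1.ne']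
        simp only [hε, Int.fract]
        push_cast; ring
      rw [← hu, e, Int.fract_sub_intCast] at h2
      have h3 := ht2 k
      simp only [hδ, hY] at h3
      push_cast at h2
      rw [le_div_iff₀ hb]
      simp only [hδ]
      linarith
    have hfr0 : Filter.Tendsto (fun k => Int.fract (z k)) Filter.atTop (nhds 0) :=
      squeeze_zero (fun k => Int.fract_nonneg _) hfr (by simpa using hδφ.div_const b)
    have hfl : Filter.Tendsto (fun k => ((⌊z k⌋ : ℤ) : ℝ)) Filter.atTop (nhds (j * u - Y * μ)) := by
      have := hzlim.sub hfr0
      simpa [Int.self_sub_fract] using this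
    have hmem := Int.isClosedEmbedding_coe_real.isClosed_range.mem_of_tendsto hfl
      (Filter.Eventually.of_forall fun k => ⟨⌊z k⌋, rfl⟩)
    exact hmem
  obtain ⟨z, hz⟩ := claim 0 (-1)
  obtain ⟨n, hn⟩ := claim 1 0
  have hμz : μ = ((-z : ℤ) : ℝ) := by push_cast; push_cast at hz; linarith
  generalize -z = m at hμz
  rw [hμz] at hn hμ
  have hun : u = m * a + n := by push_cast at hn; linarith
  have hm : 0 ≤ m := by exact_mod_cast hμ.1
  refine ⟨m, n, hm, ?_, hun⟩
  have hm' : (0 : ℝ) ≤ m := by exact_mod_cast hm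
  have hbm : b * m < 1 := by
    set k := m.toNat with hk
    have hkm : (k : ℝ) = m := by exact_mod_cast Int.toNat_of_nonneg hm
    have h1 := hεδ k
    have h2 : 0 < δ k := hpos k
    have h3 : δ k < 1 / ((k : ℝ) + 1) := hlt k
    have e : (J k : ℝ) * u = m * δ k + ((m * L k + J k * n : ℤ) : ℝ) := by
      rw [hun]; simp only [hδ]; push_cast; ring
    rw [hkm, lt_div_iff₀ (by positivity)] at h3
    have h4 : ε k = m * δ k := by
      simp only [hε]
      rw [e, Int.fract_add_intCast, Int.fract_eq_self]
      exact ⟨by positivity, by nlinarith⟩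
    rw [h4] at h1
    by_contra hc
    push Not at hc
    nlinarith
  have h5 : a = b * (m * a + n) := by rw [← hun, hu]; field_simp
  have h6 : 0 < b * n := by nlinarith
  have h7 : (0 : ℝ) < n := (mul_pos_iff_of_pos_left hb).1 h6
  exact_mod_cast h7

theorem nd_rat (a b : ℝ) (hb : 0 < b) (p q : ℤ) (hp : 1 ≤ p) (hq : 1 ≤ q) (hpq : IsCoprime p q)
    (h : a = q / p) (hC : NDCond a b) (hbp : 1 / p < b) :
    ∃ m n r : ℤ, 0 ≤ m ∧ 1 ≤ n ∧ 1 ≤ r ∧ (r : ℝ) = p * b * (r + m / p + n / q - 1) := by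
  have hp' : (0 : ℝ) < p := by exact_mod_cast hp
  have hq' : (0 : ℝ) < q := by exact_mod_cast hq
  obtain ⟨l0, j0, hj0⟩ := hpq
  set u := a / b with hu
  have hθ : 1 / (p * b) < 1 := by
    rw [div_lt_one (by positivity)]
    rw [div_lt_iff₀ hp'] at hbp; linarith
  have hline : ∀ t : ℤ, Int.fract ((j0 : ℝ) * u + t * (p * u)) < 1 / (p * b) := by
    intro t
    have hj0' : (l0 : ℝ) * p + j0 * q = 1 := by exact_mod_cast hj0
    have e1 : ((j0 + t * p : ℤ) : ℝ) * a - ((t * q - l0 : ℤ) : ℝ) = 1 / p := by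
      rw [h]; push_cast; field_simp; linear_combination hj0'
    have h1 := hC (j0 + t * p) (t * q - l0) (by
      have : 0 < 1 / (p : ℝ) := by positivity
      linarith)
    rw [e1, ← hu] at h1
    have e2 : ((j0 + t * p : ℤ) : ℝ) * u = (j0 : ℝ) * u + t * (p * u) := by push_cast; ring
    rw [e2] at h1
    rw [lt_div_iff₀ (by positivity)]
    rw [lt_div_iff₀ hp'] at h1
    linarith
  have hnirr : ¬ Irrational (p * u) := by
    intro hirr
    obtain ⟨t, s, h1, h2⟩ := nd_dense (p * u) hirr (1 / (p * b) - j0 * u) (1 - j0 * u) (by linarith)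
    have h3 := hline t
    have hpos : 0 < 1 / (p * b) := by positivity
    have e : Int.fract ((j0 : ℝ) * u + t * (p * u)) = j0 * u + t * (p * u) + s := by
      rw [← Int.fract_add_intCast _ s, Int.fract_eq_self]
      constructor <;> linarith
    linarith
  rw [Irrational, not_not] at hnirr
  obtain ⟨w, hw⟩ := hnirr
  set r : ℤ := (w.den : ℤ) with hr
  set c : ℤ := w.num with hc
  have hr1 : 1 ≤ r := by have := w.pos; omega
  have hr' : (0 : ℝ) < r := by exact_mod_cast hr1
  have hw' : r * (p * u) = c := by
    rw [← hw, hr, hc]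
    have := Rat.den_mul_eq_num w
    exact_mod_cast this
  have hcop : IsCoprime c r := by
    rw [Int.isCoprime_iff_gcd_eq_one]; simpa [hc, hr, Int.gcd] using w.reduced
  obtain ⟨A, B, hAB⟩ := hcop
  set m : ℤ := (j0 * c) % p with hm
  set e : ℤ := (j0 * c) / p with he
  have hme : m + p * e = j0 * c := Int.emod_add_mul_ediv _ _
  have hm0 : 0 ≤ m := Int.emod_nonneg _ (by omega)
  have hmp : m < p := Int.emod_lt_of_pos _ (by omega)
  have hme' : (m : ℝ) + p * e = j0 * c := by exact_mod_cast hme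
  have hrj : r * (j0 * u) = m / p + e := by
    field_simp
    linear_combination (j0 : ℝ) * hw' - hme'
  set t : ℤ := A * (r - 1 - e) with ht
  set s : ℤ := -B * (r - 1 - e) with hs
  have hts : e + t * c = r - 1 + r * s := by
    rw [ht, hs]; linear_combination (r - 1 - e) * hAB
  have hts' : (e : ℝ) + t * c = r - 1 + r * s := by exact_mod_cast hts
  have hm0' : (0 : ℝ) ≤ m := by exact_mod_cast hm0
  have hmp' : (m : ℝ) / p < 1 := by rw [div_lt_one hp']; exact_mod_cast hmp
  have hr1' : (1 : ℝ) ≤ r := by exact_mod_cast hr1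
  have hfr : Int.fract ((j0 : ℝ) * u + t * (p * u)) = (m / p + (r - 1)) / r := by
    have e1 : (j0 : ℝ) * u + t * (p * u) = (m / p + (r - 1)) / r + s := by
      rw [← sub_eq_iff_eq_add, eq_div_iff hr'.ne']
      linear_combination hrj + (t : ℝ) * hw' + hts'
    rw [e1, Int.fract_add_intCast, Int.fract_eq_self]
    constructor
    · apply div_nonneg _ hr'.le
      have : 0 ≤ (m : ℝ) / p := by positivity
      linarith
    · rw [div_lt_one hr']; linarith
  have hlt := hline t
  rw [hfr] at hlt
  have hj0' : (l0 : ℝ) * p + j0 * q = 1 := by exact_mod_cast hj0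
  set C : ℤ := q * e + l0 * c with hCdef
  have hru : r * u = m * (q / p) + C := by
    rw [hCdef]; push_cast
    linear_combination (q : ℝ) * hrj + (l0 : ℝ) * hw' - (r * u) * hj0'
  have hub : 1 / (p * b) = u / q := by
    rw [hu, h]; field_simp
  have hmain : (m : ℝ) / p + (r - 1) < m / p + C / q := by
    rw [div_lt_iff₀ hr', hub] at hlt
    have : u / q * r = m / p + C / q := by
      have : u / q * r = (r * u) / q := by ring
      rw [this, hru]; field_simp
    linarith
  have hn : (r - 1) * q < C := by
    have : ((r : ℝ) - 1) < C / q := by linarith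
    rw [lt_div_iff₀ hq'] at this
    exact_mod_cast this
  refine ⟨m, C - (r - 1) * q, r, hm0, by omega, hr1, ?_⟩
  have h8 : (r : ℝ) + m / p + ((C - (r - 1) * q : ℤ) : ℝ) / q - 1 = r * u / q := by
    rw [hru]; push_cast; field_simp; ring
  rw [h8, hu, h]; field_simp

theorem nd_form (b p q m n r : ℝ) (hb : 0 < b) (hp : 0 < p) (hr : 0 < r) :
    (-b = -(1 / p) * (1 + (1 / r) * (m / p + n / q - 1))⁻¹) ↔
      r = p * b * (r + m / p + n / q - 1) := by
  set T := m / p + n / q - 1 with hT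
  have e0 : r + m / p + n / q - 1 = r + T := by rw [hT]; ring
  have e1 : 1 + 1 / r * T = (r + T) / r := by field_simp
  rw [e0, e1, inv_div]
  constructor
  · intro h
    have hne : r + T ≠ 0 := by
      intro h0
      rw [h0] at h; simp at h; linarith
    field_simp at h
    linarith
  · intro h
    have hne : r + T ≠ 0 := by
      intro h0
      rw [h0] at h; simp at h; linarith
    field_simp
    linarith

theorem negative_dilations_classification (α β : ℝ) (hα : α < 0) (hβ : β < 0) :
    (∀ x : ℝ, ⌊α * (⌊β * x⌋ : ℝ)⌋ ≥ ⌊β * (⌊α * x⌋ : ℝ)⌋) ↔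
    ((∃ m n : ℤ, 0 ≤ m ∧ 1 ≤ n ∧ (m : ℝ) * α * β - (n : ℝ) * β = -α) ∨
     (∃ p q : ℤ, 1 ≤ p ∧ 1 ≤ q ∧ IsCoprime p q ∧
        α = -(q : ℝ) / (p : ℝ) ∧ -(1 : ℝ) / (p : ℝ) ≤ β ∧ β < 0) ∨
     (∃ p q m n r : ℤ, 1 ≤ p ∧ 1 ≤ q ∧ IsCoprime p q ∧ 0 ≤ m ∧ 1 ≤ n ∧ 1 ≤ r ∧
        α = -(q : ℝ) / (p : ℝ) ∧
        β = -(1 / (p : ℝ)) *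
          (1 + (1 / (r : ℝ)) * ((m : ℝ) / (p : ℝ) + (n : ℝ) / (q : ℝ) - 1))⁻¹)) := by
  rw [ndCond_iff α β hα hβ]
  obtain ⟨a, rfl⟩ : ∃ a, α = -a := ⟨-α, by ring⟩
  obtain ⟨b, rfl⟩ : ∃ b, β = -b := ⟨-β, by ring⟩
  simp only [neg_neg]
  have ha : 0 < a := by linarith
  have hb : 0 < b := by linarith
  constructor
  · intro hC
    by_cases hirr : Irrational a
    · left
      obtain ⟨m, n, hm, hn, h⟩ := nd_irr a b ha hb hirr hC
      refine ⟨m, n, hm, hn, ?_⟩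
      rw [div_eq_iff hb.ne'] at h
      linear_combination -h
    · right
      rw [Irrational, not_not] at hirr
      obtain ⟨w, hw⟩ := hirr
      have hw0 : 0 < w := by rw [← hw] at ha; exact_mod_cast ha
      have hp : 1 ≤ (w.den : ℤ) := by have := w.pos; omega
      have hq : 1 ≤ w.num := Rat.num_pos.2 hw0
      have hcop : IsCoprime (w.den : ℤ) w.num := by
        apply IsCoprime.symm
        rw [Int.isCoprime_iff_gcd_eq_one]; simpa [Int.gcd] using w.reduced
      have haw : a = (w.num : ℝ) / ((w.den : ℤ) : ℝ) := by
        rw [← hw, Int.cast_natCast]; exact Rat.cast_def w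
      generalize (w.den : ℤ) = p at hp hcop haw
      generalize w.num = q at hq hcop haw
      have hp' : (0 : ℝ) < p := by exact_mod_cast hp
      have haw' : -a = -(q : ℝ) / p := by rw [haw]; ring
      by_cases hbp : 1 / (p : ℝ) < b
      · right
        obtain ⟨m, n, r, hm, hn, hr, h⟩ := nd_rat a b hb p q hp hq hcop haw hC hbp
        exact ⟨p, q, m, n, r, hp, hq, hcop, hm, hn, hr, haw',
          (nd_form b p q m n r hb hp' (by exact_mod_cast hr)).2 h⟩
      · left
        refine ⟨p, q, hp, hq, hcop, haw', ?_, hβ⟩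
        push Not at hbp
        rw [neg_div]; linarith
  · rintro (⟨m, n, hm, hn, h⟩ | ⟨p, q, hp, hq, -, h, hbp, -⟩ |
      ⟨p, q, m, n, r, hp, hq, -, hm, hn, hr, h, hbp⟩)
    · refine nd_suff_one a b ha hb m n hm hn ?_
      rw [div_eq_iff hb.ne']; linear_combination -h
    · refine nd_suff_two a b hb p q hp ?_ ?_
      · rw [neg_div] at h; linarith
      · rw [neg_div] at hbp; linarith
    · have hp' : (0 : ℝ) < p := by exact_mod_cast hp
      refine nd_suff_three a b hb p q m n r hp hq hm hn hr ?_
        ((nd_form b p q m n r hb hp' (by exact_mod_cast hr)).1 hbp)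
      rw [neg_div] at h; linarith
end

section
/- Let σ, τ > 0 be real numbers and suppose ⌊(−σ/τ)⌊(−σ)x⌋⌋ ≥ ⌊(−σ)⌊(−σ/τ)x⌋⌋ holds for all real x. Then: (a) if at least one of σ, τ is irrational, then exactly one of the following holds: (i*) there exist integers m ≥ 0 and n ≥ 1 such that mσ + nτ = 1; (ii*) there exist coprime integers p, q ≥ 1 such that pσ = qτ ≤ 1; (b) if σ and τ are both rational, then there exist coprime integers p, q ≥ 1 and integers m ≥ 0, n ≥ 1, r ≥ 1 such that pσ = qτ = (1 + (1/r)·(m/p + n/q − 1))⁻¹. -/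
open Filter Topology

lemma ndn_key (σ τ : ℝ) (hσ : 0 < σ) (hτ : 0 < τ)
    (h : ∀ x : ℝ, ⌊(-σ / τ) * (⌊(-σ) * x⌋ : ℝ)⌋ ≥ ⌊(-σ) * (⌊(-σ / τ) * x⌋ : ℝ)⌋)
    (n A B : ℤ) (h1 : (B : ℝ) * σ < n * τ) (h2 : (n : ℝ) ≤ σ * (A + 1)) :
    (B : ℝ) ≤ τ * A := by
  by_contra hc
  push Not at hc
  have hx := h (B / σ)
  have e1 : (-σ) * ((B : ℝ) / σ) = ((-B : ℤ) : ℝ) := by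
    push_cast; field_simp
  rw [e1, Int.floor_intCast] at hx
  have l1 : ⌊(-σ / τ) * ((-B : ℤ) : ℝ)⌋ < n := by
    rw [Int.floor_lt]
    push_cast
    have : -σ / τ * -(B : ℝ) = B * σ / τ := by ring
    rw [this, div_lt_iff₀ hτ]
    exact h1
  have l2 : ⌊(-σ / τ) * ((B : ℝ) / σ)⌋ < -A := by
    rw [Int.floor_lt]
    push_cast
    have : -σ / τ * ((B : ℝ) / σ) = - (B / τ) := by field_simp
    rw [this, neg_lt_neg_iff, lt_div_iff₀ hτ]
    linarith
  have l3 : n ≤ ⌊(-σ) * (⌊(-σ / τ) * ((B : ℝ) / σ)⌋ : ℝ)⌋ := by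
    rw [Int.le_floor]
    have l4 : ⌊(-σ / τ) * ((B : ℝ) / σ)⌋ ≤ -A - 1 := by omega
    have l5 : (⌊(-σ / τ) * ((B : ℝ) / σ)⌋ : ℝ) ≤ -A - 1 := by exact_mod_cast l4
    nlinarith
  omega

/-- The rational case. -/
lemma ndn_rat (σ τ : ℝ) (hσ : 0 < σ) (hτ : 0 < τ)
    (key : ∀ n A B : ℤ, (B : ℝ) * σ < n * τ → (n : ℝ) ≤ σ * (A + 1) → (B : ℝ) ≤ τ * A)
    (h1 : ¬ Irrational σ) (h2 : ¬ Irrational τ) :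
    ∃ p q m n r : ℤ, 1 ≤ p ∧ 1 ≤ q ∧ IsCoprime p q ∧ 0 ≤ m ∧ 1 ≤ n ∧ 1 ≤ r ∧
        (p : ℝ) * σ = (q : ℝ) * τ ∧
        (p : ℝ) * σ =
          (1 + (1 / (r : ℝ)) * ((m : ℝ) / (p : ℝ) + (n : ℝ) / (q : ℝ) - 1))⁻¹ := by
  have rat : ∀ x : ℝ, 0 < x → (∃ a : ℚ, (a : ℝ) = x) →
      ∃ a b : ℤ, 0 < a ∧ 0 < b ∧ IsCoprime a b ∧ (b : ℝ) * x = a := by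
    rintro x hx ⟨a, rfl⟩
    have ha : 0 < a := by exact_mod_cast hx
    refine ⟨a.num, a.den, Rat.num_pos.2 ha, by exact_mod_cast a.den_pos, ?_, ?_⟩
    · rw [Int.isCoprime_iff_gcd_eq_one]
      exact a.reduced
    · have := Rat.den_mul_eq_num a
      exact_mod_cast this
  obtain ⟨s, hs⟩ : ∃ a : ℚ, (a : ℝ) = σ := by
    simpa [Irrational] using h1
  obtain ⟨t, ht⟩ : ∃ a : ℚ, (a : ℝ) = τ := by
    simpa [Irrational] using h2
  obtain ⟨q, p, hq, hp, hqp, e1⟩ := rat (σ / τ) (by positivity) ⟨s / t, by push_cast; rw [hs, ht]⟩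
  obtain ⟨S, D, hS, hD, hSD, e2⟩ := rat (q / σ) (by positivity) ⟨q / s, by push_cast; rw [hs]⟩
  have hqR : (0 : ℝ) < q := by exact_mod_cast hq
  have hpR : (0 : ℝ) < p := by exact_mod_cast hp
  have hDR : (0 : ℝ) < D := by exact_mod_cast hD
  have hSR : (0 : ℝ) < S := by exact_mod_cast hS
  have e1' : (p : ℝ) * σ = q * τ := by field_simp at e1; linarith
  have e2' : (D : ℝ) * q = S * σ := by field_simp at e2; linarith
  -- t p ≡ 1 mod q
  obtain ⟨u, t, hut⟩ := hqp
  obtain ⟨w, z, hwz⟩ := hSD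
  -- j in [1,q], j ≡ t S mod q
  obtain ⟨i, j, hij, hj1, hjq⟩ : ∃ i j : ℤ, t * S = j + q * i ∧ 1 ≤ j ∧ j ≤ q := by
    refine ⟨(t * S - 1) / q, (t * S - 1) % q + 1, ?_, ?_, ?_⟩
    · have := Int.emod_add_mul_ediv (t * S - 1) q
      linarith
    · have := Int.emod_nonneg (t * S - 1) hq.ne'
      omega
    · have := Int.emod_lt_of_pos (t * S - 1) hq
      omega
  -- i + k S = -1 + D l
  obtain ⟨k, l, hkl⟩ : ∃ k l : ℤ, i + k * S = -1 + D * l :=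
    ⟨(-1 - i) * w, (1 + i) * z, by linear_combination (-1 - i) * hwz⟩
  have hdiv : ∃ m : ℤ, S - p * q * (D - 1) - p * j = q * m := by
    refine ⟨u * S - p * (D - 1) + p * i, ?_⟩
    linear_combination (-S) * hut + p * hij
  obtain ⟨m, hm⟩ := hdiv
  -- n = t + q k; n/σ = n S/(D q); = (j + q (i + k S))/(D q) = (j - q + q D l)/(D q)
  -- A = l - 1, B : n p = 1 + q B
  have hB : (t + q * k) * p = 1 + q * (k * p - u) := by linear_combination hut
  have hA : (t + q * k) * S = j - q + q * D * l := by
    linear_combination hij + q * hkl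
  have hBR : ((t + q * k : ℤ) : ℝ) * p = 1 + q * ((k * p - u : ℤ) : ℝ) := by exact_mod_cast hB
  have hAR : ((t + q * k : ℤ) : ℝ) * S = j - q + q * D * l := by exact_mod_cast hA
  have hj1R : (1 : ℝ) ≤ j := by exact_mod_cast hj1
  have hjqR : (j : ℝ) ≤ q := by exact_mod_cast hjq
  have hmR : (S : ℝ) - p * q * (D - 1) - p * j = q * m := by exact_mod_cast hm
  generalize (t + q * k) = n at *
  generalize (k * p - u) = B at *
  have hσe : σ = D * q / S := by field_simp; linarith
  have hτe : τ = p * D / S := by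
    have : τ = p * σ / q := by field_simp; linarith
    rw [this, hσe]; field_simp
  have hK := key n (l - 1) B (by
      rw [hσe, hτe]
      have : (B : ℝ) * (D * q / S) = D * (q * B) / S := by ring
      rw [this]
      have : (n : ℝ) * (p * D / S) = D * (n * p) / S := by ring
      rw [this, hBR]
      gcongr
      linarith) (by
      push_cast
      rw [hσe, div_mul_eq_mul_div, le_div_iff₀ hSR, hAR]
      nlinarith)
  have hm0 : (0 : ℝ) ≤ m := by
    have h3 : (B : ℝ) * S ≤ p * D * (l - 1) := by
      rw [hτe, div_mul_eq_mul_div, le_div_iff₀ hSR] at hK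
      push_cast at hK
      exact hK
    -- q * B = n p - 1
    have h4 : (q : ℝ) * (B * S) ≤ q * (p * D * (l - 1)) := by gcongr
    have h5 : (q : ℝ) * (B * S) = p * (j - q + q * D * l) - S := by
      rw [← hAR]; linear_combination (-S : ℝ) * hBR
    have : 0 ≤ (q : ℝ) * m := by rw [← hmR]; nlinarith
    exact nonneg_of_mul_nonneg_right this hqR
  refine ⟨p, q, m, j, D, by omega, by omega, ⟨t, u, by linarith⟩, by exact_mod_cast hm0, hj1,
    by omega, e1', ?_⟩
  have : (1 + (1 / (D : ℝ)) * ((m : ℝ) / (p : ℝ) + (j : ℝ) / (q : ℝ) - 1)) = S / (D * p * q) := by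
    field_simp
    linarith
  rw [this, hσe, inv_div]
  ring

/-- The lattice-like subgroup generated by `ℤ²` and `(1/σ, τ/σ)`. -/
def ndnG (σ τ : ℝ) : AddSubgroup (ℝ × ℝ) where
  carrier := {g | ∃ n A B : ℤ, g = (n / σ - A, n * τ / σ - B)}
  zero_mem' := ⟨0, 0, 0, by ext <;> simp⟩
  add_mem' := by
    rintro _ _ ⟨n, A, B, rfl⟩ ⟨n', A', B', rfl⟩
    refine ⟨n + n', A + A', B + B', ?_⟩
    ext <;> push_cast <;> simp <;> ring
  neg_mem' := by
    rintro _ ⟨n, A, B, rfl⟩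
    refine ⟨-n, -A, -B, ?_⟩
    ext <;> push_cast <;> simp <;> ring

lemma mem_ndnG {σ τ : ℝ} {g : ℝ × ℝ} :
    g ∈ ndnG σ τ ↔ ∃ n A B : ℤ, g = (n / σ - A, n * τ / σ - B) := Iff.rfl

/-- A subgroup of the plane with arbitrarily small non-zero elements has a line in its closure. -/
lemma ndn_line (G : AddSubgroup (ℝ × ℝ)) (g : ℕ → ℝ × ℝ) (hg : ∀ k, g k ∈ G)
    (hne : ∀ k, g k ≠ 0) (hlim : Tendsto g atTop (𝓝 0)) :
    ∃ d : ℝ × ℝ, d ≠ 0 ∧ ∀ t : ℝ, t • d ∈ closure (G : Set (ℝ × ℝ)) := by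
  have hcomp : IsCompact (Metric.sphere (0 : ℝ × ℝ) 1) := isCompact_sphere 0 1
  have hmem : ∀ k, (‖g k‖⁻¹) • g k ∈ Metric.sphere (0 : ℝ × ℝ) 1 := by
    intro k
    have : ‖g k‖ ≠ 0 := norm_ne_zero_iff.2 (hne k)
    simp [norm_smul, this]
  obtain ⟨d, hd, φ, hφ, hlim2⟩ := hcomp.tendsto_subseq hmem
  refine ⟨d, ?_, ?_⟩
  · rintro rfl
    simp at hd
  intro t
  have hn0 : Tendsto (fun k => ‖g (φ k)‖) atTop (𝓝 0) := by
    have := (hlim.comp hφ.tendsto_atTop).norm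
    simpa using this
  have hcoef : Tendsto (fun k => (⌊t / ‖g (φ k)‖⌋ : ℝ) * ‖g (φ k)‖) atTop (𝓝 t) := by
    have h0 : Tendsto (fun k => t - ‖g (φ k)‖) atTop (𝓝 t) := by
      simpa using hn0.const_sub t
    refine tendsto_of_tendsto_of_tendsto_of_le_of_le h0 tendsto_const_nhds ?_ ?_
    · intro k
      have hp : 0 < ‖g (φ k)‖ := norm_pos_iff.2 (hne _)
      have := Int.lt_floor_add_one (t / ‖g (φ k)‖)
      rw [div_lt_iff₀ hp] at this
      simp only
      nlinarith
    · intro k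
      have hp : 0 < ‖g (φ k)‖ := norm_pos_iff.2 (hne _)
      have := Int.floor_le (t / ‖g (φ k)‖)
      rw [le_div_iff₀ hp] at this
      exact this
  have hl := hcoef.smul hlim2
  refine mem_closure_of_tendsto hl (Eventually.of_forall fun k => ?_)
  have hp : ‖g (φ k)‖ ≠ 0 := norm_ne_zero_iff.2 (hne _)
  have : ((⌊t / ‖g (φ k)‖⌋ : ℝ) * ‖g (φ k)‖) •
      ((fun k => (‖g k‖⁻¹) • g k) ∘ φ) k = ⌊t / ‖g (φ k)‖⌋ • g (φ k) := by
    simp only [Function.comp]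
    rw [smul_smul, mul_assoc, mul_inv_cancel₀ hp, mul_one, Int.cast_smul_eq_zsmul]
  rw [this]
  exact G.zsmul_mem (hg _) _

lemma ndn_small (σ τ : ℝ) (hσ : 0 < σ) (hirr : Irrational σ ∨ Irrational τ) :
    ∃ g : ℕ → ℝ × ℝ, (∀ k, g k ∈ ndnG σ τ) ∧ (∀ k, g k ≠ 0) ∧ Tendsto g atTop (𝓝 0) := by
  let x : ℕ → ℝ × ℝ := fun n => (Int.fract ((n : ℝ) / σ), Int.fract ((n : ℝ) * τ / σ))
  have hxG : ∀ n, x n ∈ ndnG σ τ := fun n =>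
    ⟨n, ⌊(n : ℝ) / σ⌋, ⌊(n : ℝ) * τ / σ⌋, by simp [x]⟩
  have hxi : Function.Injective x := by
    intro a b hab
    by_contra hne
    simp only [x, Prod.mk.injEq] at hab
    obtain ⟨A, hA⟩ := Int.fract_eq_fract.1 hab.1
    obtain ⟨B, hB⟩ := Int.fract_eq_fract.1 hab.2
    have hk : ((a : ℝ) - b) ≠ 0 := by
      rw [sub_ne_zero]; exact_mod_cast hne
    have hA' : ((a : ℝ) - b) = A * σ := by field_simp at hA; linarith
    have hA0 : (A : ℝ) ≠ 0 := by
      rintro h0; rw [h0, zero_mul] at hA'; exact hk hA'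
    have hB' : ((a : ℝ) - b) * τ = B * σ := by field_simp at hB; linarith
    have hs : σ = ((((a : ℤ) - b : ℤ) / (A : ℤ) : ℚ) : ℝ) := by
      push_cast; field_simp; linarith
    have ht : τ = (((B : ℤ) / (A : ℤ) : ℚ) : ℝ) := by
      push_cast; field_simp
      rw [hA'] at hB'
      have : σ * (τ * A - B) = 0 := by linarith
      rcases mul_eq_zero.1 this with h0 | h0
      · exact absurd h0 hσ.ne'
      · linarith
    rcases hirr with hi | hi
    · exact hi ⟨_, hs.symm⟩
    · exact hi ⟨_, ht.symm⟩
  have hcomp : IsCompact (Set.Icc (0 : ℝ) 1 ×ˢ Set.Icc (0 : ℝ) 1) := isCompact_Icc.prod isCompact_Icc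
  obtain ⟨l, -, φ, hφ, hl⟩ := hcomp.tendsto_subseq (x := x) (fun n =>
    ⟨⟨Int.fract_nonneg _, (Int.fract_lt_one _).le⟩, ⟨Int.fract_nonneg _, (Int.fract_lt_one _).le⟩⟩)
  refine ⟨fun k => x (φ (k + 1)) - x (φ k), fun k => (ndnG σ τ).sub_mem (hxG _) (hxG _), ?_, ?_⟩
  · intro k
    rw [sub_ne_zero]
    intro he
    have := hφ.injective (hxi he)
    omega
  · have h1 := hl.comp (tendsto_add_atTop_nat 1)
    simpa using h1.sub hl

/-- Structure: there is an integral relation `a σ + b τ = c` describing the closure of `ndnG`. -/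
lemma ndn_struct (σ τ : ℝ) (hσ : 0 < σ) (hτ : 0 < τ) (hirr : Irrational σ ∨ Irrational τ)
    (hU : ∀ u ∈ closure (ndnG σ τ : Set (ℝ × ℝ)), ¬ (0 < u.2 ∧ u.2 < τ * u.1 ∧ u.1 < 1)) :
    ∃ a b c : ℤ, (b ≠ 0 ∨ c ≠ 0) ∧ (a : ℝ) * σ + b * τ = c ∧
      (∃ n A B : ℤ, n * a - c * A + b * B = 1) ∧
      ∀ (X Y : ℝ) (k : ℤ), (c : ℝ) * X - b * Y = k →
        (X, Y) ∈ closure (ndnG σ τ : Set (ℝ × ℝ)) := by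
  obtain ⟨g, hg, hne, hlim⟩ := ndn_small σ τ hσ hirr
  obtain ⟨d, hd, hline⟩ := ndn_line _ g hg hne hlim
  let f : (ℝ × ℝ) →+ ℝ :=
    { toFun := fun u => d.2 * u.1 - d.1 * u.2
      map_zero' := by simp
      map_add' := by intro u v; simp; ring }
  have hf : ∀ u, f u = d.2 * u.1 - d.1 * u.2 := fun u => rfl
  have hN : 0 < d.1 ^ 2 + d.2 ^ 2 := by
    rcases (not_and_or.1 (fun h : d.1 = 0 ∧ d.2 = 0 => hd (Prod.ext h.1 h.2))) with h0 | h0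
    · positivity
    · positivity
  have hcl : ∀ u, f u ∈ (ndnG σ τ).map f → u ∈ closure (ndnG σ τ : Set (ℝ × ℝ)) := by
    rintro u ⟨w, hw, hwu⟩
    have h1 : w ∈ (ndnG σ τ).topologicalClosure := subset_closure hw
    have h2 : ((d.1 * (u.1 - w.1) + d.2 * (u.2 - w.2)) / (d.1 ^ 2 + d.2 ^ 2)) • d
        ∈ (ndnG σ τ).topologicalClosure := hline _
    have h3 := (ndnG σ τ).topologicalClosure.add_mem h1 h2
    have h4 : w + ((d.1 * (u.1 - w.1) + d.2 * (u.2 - w.2)) / (d.1 ^ 2 + d.2 ^ 2)) • d = u := by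
      rw [hf, hf] at hwu
      ext
      · simp only [Prod.fst_add, Prod.smul_fst, smul_eq_mul]
        field_simp
        linear_combination d.2 * hwu
      · simp only [Prod.snd_add, Prod.smul_snd, smul_eq_mul]
        field_simp
        linear_combination (-d.1) * hwu
    rw [h4] at h3
    exact h3
  rcases AddSubgroup.dense_or_cyclic ((ndnG σ τ).map f) with hdense | ⟨ω, hω⟩
  · exfalso
    let c0 : ℝ := d.2 * (1 / 2) - d.1 * (τ / 4)
    let ψ : ℝ → ℝ × ℝ := fun x =>
      (1 / 2 + (x - c0) / (d.1 ^ 2 + d.2 ^ 2) * d.2, τ / 4 - (x - c0) / (d.1 ^ 2 + d.2 ^ 2) * d.1)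
    have hψ : Continuous ψ := by fun_prop
    have hfψ : ∀ x, f (ψ x) = x := by
      intro x
      rw [hf]
      simp only [ψ]
      have : (x - c0) / (d.1 ^ 2 + d.2 ^ 2) * (d.1 ^ 2 + d.2 ^ 2) = x - c0 :=
        div_mul_cancel₀ _ hN.ne'
      simp only [c0] at *
      linear_combination this
    let O : Set (ℝ × ℝ) := {u | 0 < u.2 ∧ u.2 < τ * u.1 ∧ u.1 < 1}
    have hO : IsOpen O :=
      (isOpen_lt continuous_const continuous_snd).inter
        ((isOpen_lt continuous_snd (continuous_const.mul continuous_fst)).inter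
          (isOpen_lt continuous_fst continuous_const))
    have hne : (ψ ⁻¹' O).Nonempty := by
      refine ⟨c0, ?_⟩
      simp only [ψ, O, Set.mem_preimage, Set.mem_setOf_eq, sub_self, zero_div, zero_mul, add_zero,
        sub_zero]
      refine ⟨by positivity, by linarith, by norm_num⟩
    obtain ⟨x, hxO, hxS⟩ := hdense.inter_open_nonempty _ (hO.preimage hψ) hne
    refine hU (ψ x) (hcl _ ?_) hxO
    rw [hfψ]
    exact hxS
  · have hmem : ∀ u ∈ ndnG σ τ, ∃ k : ℤ, (k : ℝ) * ω = f u := by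
      intro u hu
      have : f u ∈ (ndnG σ τ).map f := ⟨u, hu, rfl⟩
      rw [hω, AddSubgroup.mem_closure_singleton] at this
      obtain ⟨k, hk⟩ := this
      exact ⟨k, by simpa using hk⟩
    obtain ⟨c, hc⟩ := hmem (1, 0) ⟨0, -1, 0, by simp⟩
    obtain ⟨b, hb⟩ := hmem (0, -1) ⟨0, 0, 1, by simp⟩
    obtain ⟨a, ha⟩ := hmem (1 / σ, τ / σ) ⟨1, 0, 0, by simp⟩
    simp only [hf] at hc hb ha
    have hc' : c * ω = d.2 := by linarith
    have hb' : b * ω = d.1 := by linarith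
    have hω0 : ω ≠ 0 := by
      rintro rfl
      apply hd
      ext <;> simp <;> linarith
    have hrel : (a : ℝ) * σ + b * τ = c := by
      apply mul_left_cancel₀ hω0
      field_simp at ha
      rw [← hc', ← hb'] at ha
      linear_combination ha
    have hfω : ∀ u, f u = (c * u.1 - b * u.2) * ω := by
      intro u; rw [hf, ← hc', ← hb']; ring
    refine ⟨a, b, c, ?_, hrel, ?_, ?_⟩
    · by_contra h0
      push Not at h0
      apply hd
      ext
      · simp [← hb', h0.1]
      · simp [← hc', h0.2]
    · have : ω ∈ (ndnG σ τ).map f := by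
        rw [hω]; exact AddSubgroup.mem_closure_singleton_self ω
      obtain ⟨_, ⟨n, A, B, rfl⟩, hw⟩ := this
      refine ⟨n, A, B, ?_⟩
      rw [hfω] at hw
      have h1 : (c : ℝ) * (n / σ - A) - b * (n * τ / σ - B) = 1 := by
        apply mul_right_cancel₀ hω0
        rw [one_mul]; exact hw
      have h2 : (n : ℝ) * a - c * A + b * B = 1 := by
        rw [← h1]
        have : (a : ℝ) = (c - b * τ) / σ := by field_simp; linarith
        rw [this]; ring
      exact_mod_cast h2
    · intro X Y k hk
      apply hcl
      rw [hω, AddSubgroup.mem_closure_singleton]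
      refine ⟨k, ?_⟩
      rw [hfω, hk]; simp

lemma ndn_irr (σ τ : ℝ) (hσ : 0 < σ) (hτ : 0 < τ)
    (key : ∀ n A B : ℤ, (B : ℝ) * σ < n * τ → (n : ℝ) ≤ σ * (A + 1) → (B : ℝ) ≤ τ * A)
    (hirr : Irrational σ ∨ Irrational τ) :
    (∃ m n : ℤ, 0 ≤ m ∧ 1 ≤ n ∧ (m : ℝ) * σ + (n : ℝ) * τ = 1) ∨
    (∃ p q : ℤ, 1 ≤ p ∧ 1 ≤ q ∧ IsCoprime p q ∧
              (p : ℝ) * σ = (q : ℝ) * τ ∧ (p : ℝ) * σ ≤ 1) := by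
  have hT : ∀ u ∈ ndnG σ τ, ¬ (0 < u.2 ∧ u.2 < τ * u.1 ∧ u.1 ≤ 1) := by
    rintro _ ⟨n, A, B, rfl⟩ ⟨h1, h2, h3⟩
    simp only at h1 h2 h3
    have := key n A B (by
      rw [sub_pos, lt_div_iff₀ hσ] at h1; exact h1) (by
      have : (n : ℝ) / σ ≤ A + 1 := by linarith
      rw [div_le_iff₀ hσ] at this; linarith)
    have e : (n : ℝ) * τ / σ = τ * (n / σ) := by ring
    rw [e] at h2
    linarith
  have hU : ∀ u ∈ closure (ndnG σ τ : Set (ℝ × ℝ)), ¬ (0 < u.2 ∧ u.2 < τ * u.1 ∧ u.1 < 1) := by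
    intro u hu hu'
    have hO : IsOpen {u : ℝ × ℝ | 0 < u.2 ∧ u.2 < τ * u.1 ∧ u.1 < 1} :=
      (isOpen_lt continuous_const continuous_snd).inter
        ((isOpen_lt continuous_snd (continuous_const.mul continuous_fst)).inter
          (isOpen_lt continuous_fst continuous_const))
    obtain ⟨w, hw, hwG⟩ := mem_closure_iff.1 hu _ hO hu'
    exact hT w hwG ⟨hw.1, hw.2.1, hw.2.2.le⟩
  obtain ⟨a, b, c, hbc, hrel, hgen, hcl⟩ := ndn_struct σ τ hσ hτ hirr hU
  have hno : ∀ (X Y : ℝ) (k : ℤ), (c : ℝ) * X - b * Y = k → 0 < Y → Y < τ * X → X < 1 → False :=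
    fun X Y k hk h1 h2 h3 => hU _ (hcl X Y k hk) ⟨h1, h2, h3⟩
  clear hU
  -- normalise the sign
  obtain ⟨a, b, c, hbc, hrel, hgen, hcl, hno, hpos⟩ : ∃ a b c : ℤ, (b ≠ 0 ∨ c ≠ 0) ∧
      (a : ℝ) * σ + b * τ = c ∧
      (∃ n A B : ℤ, n * a - c * A + b * B = 1) ∧
      (∀ (X Y : ℝ) (k : ℤ), (c : ℝ) * X - b * Y = k →
        (X, Y) ∈ closure (ndnG σ τ : Set (ℝ × ℝ))) ∧
      (∀ (X Y : ℝ) (k : ℤ), (c : ℝ) * X - b * Y = k → 0 < Y → Y < τ * X → X < 1 → False) ∧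
      (0 < c ∨ (c = 0 ∧ 0 < b)) := by
    by_cases hp : 0 < c ∨ (c = 0 ∧ 0 < b)
    · exact ⟨a, b, c, hbc, hrel, hgen, hcl, hno, hp⟩
    · obtain ⟨n, A, B, hg⟩ := hgen
      refine ⟨-a, -b, -c, by omega, by push_cast; linarith, ⟨-n, -A, -B, by linarith⟩, ?_, ?_,
        by omega⟩
      · intro X Y k hk
        exact hcl X Y (-k) (by push_cast at hk ⊢; linarith)
      · intro X Y k hk
        exact hno X Y (-k) (by push_cast at hk ⊢; linarith)
  rcases hpos with hc | ⟨rfl, hb⟩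
  · left
    have hcR : (0 : ℝ) < c := by exact_mod_cast hc
    have hc1 : c = 1 := by
      by_contra hne
      have hc2 : 2 ≤ c := by omega
      have hc2R : (2 : ℝ) ≤ c := by exact_mod_cast hc2
      -- Y small, X = (1 + b Y)/c
      have h0 : Tendsto (fun Y : ℝ => (1 + b * Y) / c) (𝓝[>] 0) (𝓝 (1 / c)) := by
        have : Continuous (fun Y : ℝ => (1 + b * Y) / c) := by fun_prop
        have := (this.tendsto 0).mono_left (nhdsWithin_le_nhds (s := Set.Ioi 0))
        simpa using this
      have h1 : ∀ᶠ Y : ℝ in 𝓝[>] 0, (1 + b * Y) / c < 1 :=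
        h0.eventually_lt_const (by rw [div_lt_one hcR]; linarith)
      have h2 : ∀ᶠ Y : ℝ in 𝓝[>] 0, 0 < τ * ((1 + b * Y) / c) - Y := by
        have h3 : Tendsto (fun Y : ℝ => τ * ((1 + b * Y) / c) - Y) (𝓝[>] 0) (𝓝 (τ * (1 / c) - 0)) :=
          (h0.const_mul τ).sub (tendsto_id.mono_left nhdsWithin_le_nhds)
        exact h3.eventually_const_lt (by rw [sub_zero]; positivity)
      have h3 : ∀ᶠ Y : ℝ in 𝓝[>] 0, 0 < Y := eventually_mem_nhdsWithin
      obtain ⟨Y, ⟨h1, h2⟩, h3⟩ := ((h1.and h2).and h3).exists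
      exact hno ((1 + b * Y) / c) Y 1 (by push_cast; field_simp; ring) h3 (by linarith) h1
    subst hc1
    push_cast at *
    have ha : 0 ≤ a := by
      by_contra hneg
      have haR : (a : ℝ) < 0 := by push Not at hneg; exact_mod_cast hneg
      have hbt : 1 < b * τ := by nlinarith
      have hb : (0 : ℝ) < b := by
        by_contra h0
        nlinarith
      refine hno (1 / 2) (1 / (2 * b)) 0 (by push_cast; field_simp; ring) (by positivity) ?_ (by norm_num)
      rw [div_lt_iff₀ (by positivity)]
      nlinarith
    have hb0 : 0 ≤ b := by
      by_contra hneg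
      have hbR : (b : ℝ) < 0 := by push Not at hneg; exact_mod_cast hneg
      have hD : 0 < 1 - τ * b := by nlinarith
      have hY : 0 < τ / (2 * (1 - τ * b)) := by positivity
      have hYe : τ / (2 * (1 - τ * b)) * (1 - τ * b) = τ / 2 := by field_simp
      refine hno (1 + b * (τ / (2 * (1 - τ * b)))) (τ / (2 * (1 - τ * b))) 1 (by push_cast; ring)
        hY ?_ ?_
      · nlinarith
      · nlinarith
    have hb1 : b ≠ 0 := by
      rintro rfl
      have hmem := hcl 1 (τ / 2) 1 (by push_cast; ring)
      have hO : IsOpen {u : ℝ × ℝ | 0 < u.2 ∧ u.2 < τ ∧ 0 < u.1 ∧ u.1 < 2} :=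
        (isOpen_lt continuous_const continuous_snd).inter
          ((isOpen_lt continuous_snd continuous_const).inter
            ((isOpen_lt continuous_const continuous_fst).inter
              (isOpen_lt continuous_fst continuous_const)))
      obtain ⟨w, ⟨h1, h2, h3, h4⟩, hwG⟩ := mem_closure_iff.1 hmem _ hO
        ⟨by simp; positivity, by simp; linarith, by norm_num, by norm_num⟩
      have hw1 : w.1 = 1 := by
        obtain ⟨n, A, B, rfl⟩ := hwG
        simp only at h3 h4 ⊢
        have : (n : ℝ) / σ = n * a := by
          field_simp
          push_cast at hrel
          linear_combination (-(n : ℝ)) * hrel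
        rw [this] at h3 h4 ⊢
        have h3' : 0 < n * a - A := by exact_mod_cast h3
        have h4' : n * a - A < 2 := by exact_mod_cast h4
        have : n * a - A = 1 := by omega
        exact_mod_cast this
      exact hT w hwG ⟨h1, by rw [hw1]; linarith, hw1.le⟩
    exact ⟨a, b, ha, by omega, by exact_mod_cast hrel⟩
  · right
    have hbR : (0 : ℝ) < b := by exact_mod_cast hb
    push_cast at *
    have haR : (a : ℝ) < 0 := by
      by_contra h0
      push Not at h0
      have : 0 < b * τ := by positivity
      nlinarith
    have ha : a < 0 := by exact_mod_cast haR
    refine ⟨-a, b, by omega, by omega, ?_, by push_cast; linarith, ?_⟩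
    · obtain ⟨n, A, B, hg⟩ := hgen
      exact ⟨-n, B, by linarith⟩
    · by_contra h1
      push Not at h1
      push_cast at h1
      have hbt : 1 < b * τ := by linarith
      have hY : 1 / b < τ := by rw [div_lt_iff₀ hbR]; linarith
      have hY' : 1 / b / τ < 1 := by rw [div_lt_one hτ]; exact hY
      obtain ⟨X, hX1, hX2⟩ := exists_between hY'
      refine hno X (1 / b) (-1) (by push_cast; field_simp; ring) (by positivity) ?_ hX2
      rw [div_lt_iff₀ hτ] at hX1
      linarith

theorem negative_dilations_necessity (σ τ : ℝ) (hσ : 0 < σ) (hτ : 0 < τ)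
    (h : ∀ x : ℝ, ⌊(-σ / τ) * (⌊(-σ) * x⌋ : ℝ)⌋ ≥ ⌊(-σ) * (⌊(-σ / τ) * x⌋ : ℝ)⌋) :
    ((Irrational σ ∨ Irrational τ) →
      Xor' (∃ m n : ℤ, 0 ≤ m ∧ 1 ≤ n ∧ (m : ℝ) * σ + (n : ℝ) * τ = 1)
           (∃ p q : ℤ, 1 ≤ p ∧ 1 ≤ q ∧ IsCoprime p q ∧
              (p : ℝ) * σ = (q : ℝ) * τ ∧ (p : ℝ) * σ ≤ 1)) ∧
    ((¬ Irrational σ ∧ ¬ Irrational τ) →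
      ∃ p q m n r : ℤ, 1 ≤ p ∧ 1 ≤ q ∧ IsCoprime p q ∧ 0 ≤ m ∧ 1 ≤ n ∧ 1 ≤ r ∧
        (p : ℝ) * σ = (q : ℝ) * τ ∧
        (p : ℝ) * σ =
          (1 + (1 / (r : ℝ)) * ((m : ℝ) / (p : ℝ) + (n : ℝ) / (q : ℝ) - 1))⁻¹) := by
  have key := fun n A B => ndn_key σ τ hσ hτ h n A B
  refine ⟨fun hirr => ?_, fun hr => ndn_rat σ τ hσ hτ key hr.1 hr.2⟩
  have hboth : ¬ ((∃ m n : ℤ, 0 ≤ m ∧ 1 ≤ n ∧ (m : ℝ) * σ + (n : ℝ) * τ = 1) ∧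
      (∃ p q : ℤ, 1 ≤ p ∧ 1 ≤ q ∧ IsCoprime p q ∧
              (p : ℝ) * σ = (q : ℝ) * τ ∧ (p : ℝ) * σ ≤ 1)) := by
    rintro ⟨⟨m, n, hm, hn, e1⟩, ⟨p, q, hp, hq, -, e2, -⟩⟩
    have hmR : (0 : ℝ) ≤ m := by exact_mod_cast hm
    have hnR : (0 : ℝ) < n := by exact_mod_cast hn
    have hpR : (0 : ℝ) < p := by exact_mod_cast hp
    have hqR : (0 : ℝ) < q := by exact_mod_cast hq
    have hs : (((q : ℚ) / (m * q + n * p) : ℚ) : ℝ) = σ := by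
      push_cast
      rw [div_eq_iff (by positivity)]
      linear_combination (-(q : ℝ)) * e1 - n * e2
    have ht : (((p : ℚ) / (m * q + n * p) : ℚ) : ℝ) = τ := by
      push_cast
      rw [div_eq_iff (by positivity)]
      linear_combination (-(p : ℝ)) * e1 + m * e2
    rcases hirr with hi | hi
    · exact hi ⟨_, hs⟩
    · exact hi ⟨_, ht⟩
  rcases ndn_irr σ τ hσ hτ key hirr with h1 | h2
  · exact Or.inl ⟨h1, fun h2 => hboth ⟨h1, h2⟩⟩
  · exact Or.inr ⟨h2, fun h1 => hboth ⟨h1, h2⟩⟩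
end
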